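/- arXiv:math/0511260 — 2 statements merged into one kernel-verified Lean document; each statement's English description precedes it below -/
import Mathlib

section
/- Let p_k: Λ²(k) → Z₂(k) be a linear projection onto Z₂(k) and let f̃^u: Λ²(g) → Λ²(g) be the linear map given, under the isomorphism P, by the identity on Λ²(A)⊗S²(k), by id_A ⊗ p_k on A⊗Λ²(k), and by the identity on I_A⊗Λ²(k). Then f̃^u is a projection of Λ²(g) onto Z₂(g) that maps B₂(g) into itself, hence induces a 2-cocycle f^u: Λ²(g) → H₂(g) := Z₂(g)/B₂(g), and f^u is universal: for each K-vector space z the map Lin(H₂(g),z) → H²(g,z), φ ↦ [φ∘f^u], is a linear bijection. -/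
set_option linter.unusedSectionVars false
set_option synthInstance.maxHeartbeats 1000000
set_option maxHeartbeats 1000000
open scoped TensorProduct

namespace CurrentPaper

variable (K : Type*) [Field K] [CharZero K]

section Wedge

variable (V : Type*) [AddCommGroup V] [Module K V]

/-- `x ∧ y = (1/2)(x ⊗ y - y ⊗ x)` inside `V ⊗ V`. -/
noncomputable def wedge (x y : V) : V ⊗[K] V := (2 : K)⁻¹ • (x ⊗ₜ[K] y - y ⊗ₜ[K] x)

/-- `x ∨ y = (1/2)(x ⊗ y + y ⊗ x)` inside `V ⊗ V`. -/
noncomputable def vee (x y : V) : V ⊗[K] V := (2 : K)⁻¹ • (x ⊗ₜ[K] y + y ⊗ₜ[K] x)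

/-- `Λ²(V)` realized as the subspace of skew-symmetric tensors of `V ⊗ V`. -/
def lambda2 : Submodule K (V ⊗[K] V) := Submodule.span K {t | ∃ x y : V, t = wedge K V x y}

/-- `S²(V)` realized as the subspace of symmetric tensors of `V ⊗ V`. -/
def sym2 : Submodule K (V ⊗[K] V) := Submodule.span K {t | ∃ x y : V, t = vee K V x y}

variable {V}

lemma wedge_mem (x y : V) : wedge K V x y ∈ lambda2 K V := Submodule.subset_span ⟨x, y, rfl⟩

lemma vee_mem (x y : V) : vee K V x y ∈ sym2 K V := Submodule.subset_span ⟨x, y, rfl⟩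

end Wedge

section LieRelaxed

variable (L : Type*) [LieRing L] [Module K L]

/-- `∂(u ∧ v ∧ w) = ⁅u,v⁆ ∧ w + ⁅v,w⁆ ∧ u + ⁅w,u⁆ ∧ v`. -/
noncomputable def dd (u v w : L) : L ⊗[K] L :=
  wedge K L ⁅u, v⁆ w + wedge K L ⁅v, w⁆ u + wedge K L ⁅w, u⁆ v

/-- `B₂(L)`, the space of 2-boundaries, i.e. the image of `∂ : Λ³(L) → Λ²(L)`. -/
def B2 : Submodule K (L ⊗[K] L) := Submodule.span K {t | ∃ u v w : L, t = dd K L u v w}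

variable {L}

lemma dd_mem_lambda2 (u v w : L) : dd K L u v w ∈ lambda2 K L :=
  add_mem (add_mem (wedge_mem K _ _) (wedge_mem K _ _)) (wedge_mem K _ _)

lemma dd_mem_B2 (u v w : L) : dd K L u v w ∈ B2 K L := Submodule.subset_span ⟨u, v, w, rfl⟩

end LieRelaxed

section Lie

variable (L : Type*) [LieRing L] [LieAlgebra K L]

/-- The bracket `b : L ⊗ L → L`, `u ⊗ v ↦ ⁅u,v⁆`, as a linear map. -/
noncomputable def bracketHom : L ⊗[K] L →ₗ[K] L :=
  TensorProduct.lift (LinearMap.mk₂ K (fun u v => ⁅u, v⁆) add_lie smul_lie lie_add lie_smul)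

/-- `Z₂(L) = Λ²(L) ∩ ker b`, the space of 2-cycles. -/
noncomputable def Z2 : Submodule K (L ⊗[K] L) := lambda2 K L ⊓ LinearMap.ker (bracketHom K L)

/-- The derived algebra `L' = [L,L]`, as a subspace of `L`. -/
def derived : Submodule K L := Submodule.span K {m | ∃ u v : L, m = ⁅u, v⁆}

end Lie

section Alg

variable (A : Type*) [CommRing A] [Algebra K A]

/-- `I_A ⊆ S²(A)`: the kernel of the multiplication map `S²(A) → A`. -/
noncomputable def ia : Submodule K (A ⊗[K] A) := sym2 K A ⊓ LinearMap.ker (LinearMap.mul' K A)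

/-- `T(A) ⊆ Λ²(A)`: the span of the elements `ab ∧ c + bc ∧ a + ca ∧ b`. -/
def TA : Submodule K (A ⊗[K] A) :=
  Submodule.span K
    {t | ∃ a b c : A, t = wedge K A (a*b) c + wedge K A (b*c) a + wedge K A (c*a) b}

/-- `T₀(A) ⊆ Λ²(A)`: the span of the elements `ab ∧ c + bc ∧ a + ca ∧ b - abc ∧ 1`. -/
def T0A : Submodule K (A ⊗[K] A) :=
  Submodule.span K
    {t | ∃ a b c : A,
      t = wedge K A (a*b) c + wedge K A (b*c) a + wedge K A (c*a) b - wedge K A (a*b*c) 1}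

variable {A}

lemma TA_el_mem_lambda2 (a b c : A) :
    wedge K A (a*b) c + wedge K A (b*c) a + wedge K A (c*a) b ∈ lambda2 K A :=
  add_mem (add_mem (wedge_mem K _ _) (wedge_mem K _ _)) (wedge_mem K _ _)

lemma T0A_el_mem_lambda2 (a b c : A) :
    wedge K A (a*b) c + wedge K A (b*c) a + wedge K A (c*a) b - wedge K A (a*b*c) 1 ∈
      lambda2 K A :=
  sub_mem (TA_el_mem_lambda2 K a b c) (wedge_mem K _ _)

lemma ia_el_mem (a b : A) : vee K A a b - vee K A (a * b) 1 ∈ ia K A := by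
  refine Submodule.mem_inf.mpr ⟨sub_mem (vee_mem K a b) (vee_mem K _ _), ?_⟩
  simp only [LinearMap.mem_ker, map_sub, vee, map_smul, map_add, LinearMap.mul'_apply,
    mul_one, one_mul, mul_comm b a]
  simp

end Alg

section Current

variable (A : Type*) [CommRing A] [Algebra K A]
variable (k : Type*) [LieRing k] [LieAlgebra K k]

lemma g_smul_lie (c : K) (x y : A ⊗[K] k) : ⁅c • x, y⁆ = c • ⁅x, y⁆ := by
  rw [← algebraMap_smul A c x, ← algebraMap_smul A c ⁅x, y⁆, smul_lie]

lemma g_lie_smul (c : K) (x y : A ⊗[K] k) : ⁅x, c • y⁆ = c • ⁅x, y⁆ := by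
  rw [← algebraMap_smul A c y, ← algebraMap_smul A c ⁅x, y⁆, lie_smul]

/-- The bracket of the current algebra `g = A ⊗ k`, as a `K`-linear map `g ⊗ g → g`. -/
noncomputable def gBracket : (A ⊗[K] k) ⊗[K] (A ⊗[K] k) →ₗ[K] A ⊗[K] k :=
  TensorProduct.lift (LinearMap.mk₂ K (fun u v => ⁅u, v⁆) add_lie
    (fun c x y => g_smul_lie K A k c x y) lie_add (fun c x y => g_lie_smul K A k c x y))

/-- `Z₂(g) = Λ²(g) ∩ ker b` for the current algebra `g = A ⊗ k`. -/
noncomputable def Z2g : Submodule K ((A ⊗[K] k) ⊗[K] (A ⊗[K] k)) :=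
  lambda2 K (A ⊗[K] k) ⊓ LinearMap.ker (gBracket K A k)

/-- The first summand `Λ²(A) ⊗ S²(k)` of the decomposition of `Λ²(A ⊗ k)`. -/
abbrev M1 := (↥(lambda2 K A)) ⊗[K] (↥(sym2 K k))

/-- The second summand `A ⊗ Λ²(k)` of the decomposition of `Λ²(A ⊗ k)`. -/
abbrev M2 := A ⊗[K] (↥(lambda2 K k))

/-- The third summand `I_A ⊗ Λ²(k)` of the decomposition of `Λ²(A ⊗ k)`. -/
abbrev M3 := (↥(ia K A)) ⊗[K] (↥(lambda2 K k))

/-- The target of the isomorphism `P = (p₁,p₂,p₃)`. -/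
abbrev Wspace := M1 K A k × M2 K A k × M3 K A k

variable {A k}

/-- The property characterizing the linear isomorphism
`P = (p₁,p₂,p₃) : Λ²(A ⊗ k) ≅ (Λ²(A) ⊗ S²(k)) ⊕ (A ⊗ Λ²(k)) ⊕ (I_A ⊗ Λ²(k))`:
`p₁(ax ∧ by) = a ∧ b ⊗ x ∨ y`, `p₂(ax ∧ by) = ab ⊗ x ∧ y`,
`p₃(ax ∧ by) = (a ∨ b - ab ∨ 1) ⊗ x ∧ y`. -/
def IsDecomposition (P : ↥(lambda2 K (A ⊗[K] k)) ≃ₗ[K] Wspace K A k) : Prop :=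
  ∀ (a b : A) (x y : k),
    P ⟨wedge K (A ⊗[K] k) (a ⊗ₜ x) (b ⊗ₜ y), wedge_mem K _ _⟩ =
      ((⟨wedge K A a b, wedge_mem K a b⟩ ⊗ₜ[K] ⟨vee K k x y, vee_mem K x y⟩ : M1 K A k),
       ((a * b) ⊗ₜ[K] ⟨wedge K k x y, wedge_mem K x y⟩ : M2 K A k),
       ((⟨vee K A a b - vee K A (a * b) 1, ia_el_mem K a b⟩ ⊗ₜ[K]
          ⟨wedge K k x y, wedge_mem K x y⟩ : M3 K A k)))

end Current

end CurrentPaper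

namespace CurrentPaper

universe u₄

variable (K : Type*) [Field K] [CharZero K]
variable (A : Type*) [CommRing A] [Algebra K A]
variable (k : Type*) [LieRing k] [LieAlgebra K k]

/-- The second homology space `H₂(g) = Z₂(g)/B₂(g)`, realized as the image of `Z₂(g)`
in `(g ⊗ g)/B₂(g)`. -/
noncomputable abbrev H2hom :=
  ↥(Submodule.map (B2 K (A ⊗[K] k)).mkQ (Z2g K A k))

/-- The projection `f̃ᵘ = p₁ ⊕ (id_A ⊗ p_k) ⊕ p₃ : Λ²(g) → Λ²(g)` (via `P`). -/
noncomputable def uProj (P : ↥(lambda2 K (A ⊗[K] k)) ≃ₗ[K] Wspace K A k)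
    (pk : ↥(lambda2 K k) →ₗ[K] ↥(lambda2 K k)) :
    ↥(lambda2 K (A ⊗[K] k)) →ₗ[K] ↥(lambda2 K (A ⊗[K] k)) :=
  P.symm.toLinearMap.comp
    ((LinearMap.prodMap (LinearMap.id : M1 K A k →ₗ[K] M1 K A k)
        (LinearMap.prodMap (TensorProduct.map (LinearMap.id : A →ₗ[K] A) pk)
          (LinearMap.id : M3 K A k →ₗ[K] M3 K A k))).comp P.toLinearMap)

lemma lambda2_hom_ext {V W : Type*} [AddCommGroup V] [Module K V] [AddCommGroup W] [Module K W]
    {f g : ↥(lambda2 K V) →ₗ[K] W}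
    (h : ∀ x y : V, f ⟨wedge K V x y, wedge_mem K x y⟩ = g ⟨wedge K V x y, wedge_mem K x y⟩) :
    f = g := by
  ext ⟨t, ht⟩
  induction ht using Submodule.span_induction with
  | mem t ht =>
    obtain ⟨x, y, rfl⟩ := ht
    exact h x y
  | zero => exact (map_zero f).trans (map_zero g).symm
  | add s t hs ht ihs iht =>
    exact (map_add f ⟨s, hs⟩ ⟨t, ht⟩).trans
      ((congrArg₂ _ ihs iht).trans (map_add g ⟨s, hs⟩ ⟨t, ht⟩).symm)
  | smul c t ht ih =>
    exact (map_smul f c ⟨t, ht⟩).trans ((congrArg _ ih).trans (map_smul g c ⟨t, ht⟩).symm)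

/-- The wedge `(x, y) ↦ x ∧ y` as a bilinear map `V × V → Λ²(V)`. -/
noncomputable def wedgeHom (V : Type*) [AddCommGroup V] [Module K V] :
    V →ₗ[K] V →ₗ[K] ↥(lambda2 K V) :=
  LinearMap.mk₂ K (fun x y => ⟨wedge K V x y, wedge_mem K x y⟩)
    (fun x x' y => Subtype.ext <| by
      simp only [wedge, Submodule.coe_add, TensorProduct.add_tmul, TensorProduct.tmul_add]
      module)
    (fun c x y => Subtype.ext <| by
      simp only [wedge, Submodule.coe_smul, ← TensorProduct.smul_tmul', TensorProduct.tmul_smul]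
      module)
    (fun x y y' => Subtype.ext <| by
      simp only [wedge, Submodule.coe_add, TensorProduct.add_tmul, TensorProduct.tmul_add]
      module)
    (fun c x y => Subtype.ext <| by
      simp only [wedge, Submodule.coe_smul, ← TensorProduct.smul_tmul', TensorProduct.tmul_smul]
      module)

lemma lambda2_tensor_hom_ext {V W Z : Type*} [AddCommGroup V] [Module K V]
    [AddCommGroup W] [Module K W] [AddCommGroup Z] [Module K Z]
    {f g : ↥(lambda2 K (V ⊗[K] W)) →ₗ[K] Z}
    (h : ∀ (a b : V) (x y : W),
      f ⟨wedge K (V ⊗[K] W) (a ⊗ₜ x) (b ⊗ₜ y), wedge_mem K _ _⟩ =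
        g ⟨wedge K (V ⊗[K] W) (a ⊗ₜ x) (b ⊗ₜ y), wedge_mem K _ _⟩) : f = g := by
  have key : (wedgeHom K (V ⊗[K] W)).compr₂ f = (wedgeHom K (V ⊗[K] W)).compr₂ g := by
    ext a x b y
    exact h a b x y
  exact lambda2_hom_ext K fun u v => LinearMap.congr_fun₂ key u v

lemma bracketHom_wedge (L : Type*) [LieRing L] [LieAlgebra K L] (x y : L) :
    bracketHom K L (wedge K L x y) = ⁅x, y⁆ := by
  have h : bracketHom K L (wedge K L x y) = (2 : K)⁻¹ • (⁅x, y⁆ - ⁅y, x⁆) := by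
    simp [bracketHom, wedge]
  rw [h, ← lie_skew x y]
  module

lemma gBracket_wedge (u v : A ⊗[K] k) :
    gBracket K A k (wedge K (A ⊗[K] k) u v) = ⁅u, v⁆ := by
  have h : gBracket K A k (wedge K (A ⊗[K] k) u v) = (2 : K)⁻¹ • (⁅u, v⁆ - ⁅v, u⁆) := by
    simp [gBracket, wedge]
  rw [h, ← lie_skew u v]
  module

lemma B2_le_lambda2 : B2 K (A ⊗[K] k) ≤ lambda2 K (A ⊗[K] k) := by
  refine Submodule.span_le.mpr ?_
  rintro _ ⟨u, v, w, rfl⟩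
  exact dd_mem_lambda2 K u v w

lemma B2_le_Z2g : B2 K (A ⊗[K] k) ≤ Z2g K A k := by
  refine le_inf (B2_le_lambda2 K A k) (Submodule.span_le.mpr ?_)
  rintro _ ⟨u, v, w, rfl⟩
  have h := lie_jacobi w u v
  simp only [SetLike.mem_coe, LinearMap.mem_ker, dd, map_add, gBracket_wedge]
  rw [← lie_skew ⁅u, v⁆ w, ← lie_skew ⁅v, w⁆ u, ← lie_skew ⁅w, u⁆ v, ← neg_eq_zero, ← h]
  abel

lemma gBracket_eq_lTensor (P : ↥(lambda2 K (A ⊗[K] k)) ≃ₗ[K] Wspace K A k)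
    (hP : IsDecomposition K P) (t : ↥(lambda2 K (A ⊗[K] k))) :
    gBracket K A k t =
      ((bracketHom K k).comp (lambda2 K k).subtype).lTensor A (P t).2.1 := by
  have h : (gBracket K A k).comp (lambda2 K (A ⊗[K] k)).subtype =
      (((bracketHom K k).comp (lambda2 K k).subtype).lTensor A).comp
        ((LinearMap.fst K _ _).comp ((LinearMap.snd K _ _).comp P.toLinearMap)) := by
    refine lambda2_tensor_hom_ext K fun a b x y => ?_
    simp [hP a b x y, gBracket_wedge, bracketHom_wedge, LieAlgebra.ExtendScalars.bracket_tmul]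
  exact LinearMap.congr_fun h t

lemma exists_eq_comp_of_ker_le {V W Z : Type*} [AddCommGroup V] [Module K V]
    [AddCommGroup W] [Module K W] [AddCommGroup Z] [Module K Z]
    (f : V →ₗ[K] W) (g : V →ₗ[K] Z) (h : LinearMap.ker f ≤ LinearMap.ker g) :
    ∃ s : W →ₗ[K] Z, ∀ v, g v = s (f v) := by
  obtain ⟨r, hr⟩ := f.rangeRestrict.exists_rightInverse_of_surjective f.range_rangeRestrict
  obtain ⟨s, hs⟩ := (g.comp r).exists_extend
  refine ⟨s, fun v => ?_⟩
  have h1 : s (f v) = g (r (f.rangeRestrict v)) := LinearMap.congr_fun hs (f.rangeRestrict v)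
  have h2 : f.rangeRestrict (r (f.rangeRestrict v)) = f.rangeRestrict v :=
    LinearMap.congr_fun hr (f.rangeRestrict v)
  have h3 : f (r (f.rangeRestrict v)) = f v := congrArg Subtype.val h2
  have h4 : v - r (f.rangeRestrict v) ∈ LinearMap.ker f := by
    rw [LinearMap.mem_ker, map_sub, h3, sub_self]
  rw [h1, ← sub_eq_zero, ← map_sub]
  exact h h4

lemma gBracket_uProj (P : ↥(lambda2 K (A ⊗[K] k)) ≃ₗ[K] Wspace K A k)
    (hP : IsDecomposition K P) (pk : ↥(lambda2 K k) →ₗ[K] ↥(lambda2 K k))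
    (hpk1 : ∀ s : ↥(lambda2 K k), ((pk s : ↥(lambda2 K k)) : k ⊗[K] k) ∈ Z2 K k)
    (t : ↥(lambda2 K (A ⊗[K] k))) : gBracket K A k (uProj K A k P pk t) = 0 := by
  have h0 : ((bracketHom K k).comp (lambda2 K k).subtype).comp pk = 0 :=
    LinearMap.ext fun s => (hpk1 s).2
  have h1 : (P (uProj K A k P pk t)).2.1 = pk.lTensor A (P t).2.1 := by
    simp [uProj, LinearMap.lTensor]
  rw [gBracket_eq_lTensor K A k P hP, h1, ← LinearMap.lTensor_comp_apply, h0,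
    LinearMap.lTensor_zero, LinearMap.zero_apply]

/-- The complementary projection `1 - f̃ᵘ` factors through the bracket. -/
lemma exists_uProj_add_eq (P : ↥(lambda2 K (A ⊗[K] k)) ≃ₗ[K] Wspace K A k)
    (hP : IsDecomposition K P) (pk : ↥(lambda2 K k) →ₗ[K] ↥(lambda2 K k))
    (hpk2 : ∀ s : ↥(lambda2 K k), (s : k ⊗[K] k) ∈ Z2 K k → pk s = s) :
    ∃ σ : (A ⊗[K] k) →ₗ[K] ↥(lambda2 K (A ⊗[K] k)),
      ∀ t, uProj K A k P pk t + σ (gBracket K A k t) = t := by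
  obtain ⟨s, hs⟩ := exists_eq_comp_of_ker_le K ((bracketHom K k).comp (lambda2 K k).subtype)
    (LinearMap.id - pk) (fun v hv => by
      rw [LinearMap.mem_ker, LinearMap.sub_apply, hpk2 v ⟨v.2, hv⟩, LinearMap.id_apply, sub_self])
  refine ⟨P.symm.toLinearMap.comp ((LinearMap.inr K (M1 K A k) (M2 K A k × M3 K A k)).comp
    ((LinearMap.inl K (M2 K A k) (M3 K A k)).comp (s.lTensor A))), fun t => P.injective ?_⟩
  have h0 : s.comp ((bracketHom K k).comp (lambda2 K k).subtype) = LinearMap.id - pk :=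
    LinearMap.ext fun v => (hs v).symm
  have h1 : s.lTensor A (gBracket K A k t) = (P t).2.1 - pk.lTensor A (P t).2.1 := by
    rw [gBracket_eq_lTensor K A k P hP, ← LinearMap.lTensor_comp_apply, h0,
      LinearMap.lTensor_sub, LinearMap.lTensor_id]
    rfl
  rw [map_add]
  ext1
  · simp [uProj]
  · ext1
    · simp [uProj, h1]
      exact add_sub_cancel (pk.lTensor A (P t).2.1) (P t).2.1
    · simp [uProj]

/-- **a universal cocycle.** If `p_k` is a linear projection of `Λ²(k)`
onto `Z₂(k)`, then `f̃ᵘ := p₁ ⊕ (id_A ⊗ p_k) ⊕ p₃` is a projection of `Λ²(g)` onto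
`Z₂(g)` mapping `B₂(g)` into itself; hence it induces a 2-cocycle
`fᵘ : Λ²(g) → H₂(g) = Z₂(g)/B₂(g)`, and `fᵘ` is universal: for each vector space `z`
the map `φ ↦ [φ ∘ fᵘ]`, `Lin(H₂(g), z) → H²(g,z)`, is a linear bijection. -/
theorem statement15
    (P : ↥(lambda2 K (A ⊗[K] k)) ≃ₗ[K] Wspace K A k) (hP : IsDecomposition K P)
    (pk : ↥(lambda2 K k) →ₗ[K] ↥(lambda2 K k))
    (hpk1 : ∀ s : ↥(lambda2 K k), ((pk s : ↥(lambda2 K k)) : k ⊗[K] k) ∈ Z2 K k)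
    (hpk2 : ∀ s : ↥(lambda2 K k), (s : k ⊗[K] k) ∈ Z2 K k → pk s = s) :
    (∀ t : ↥(lambda2 K (A ⊗[K] k)),
      ((uProj K A k P pk t : ↥(lambda2 K (A ⊗[K] k))) : (A ⊗[K] k) ⊗[K] (A ⊗[K] k)) ∈
        Z2g K A k) ∧
    (∀ t : ↥(lambda2 K (A ⊗[K] k)),
      (t : (A ⊗[K] k) ⊗[K] (A ⊗[K] k)) ∈ Z2g K A k → uProj K A k P pk t = t) ∧
    (∀ t : ↥(lambda2 K (A ⊗[K] k)),
      (t : (A ⊗[K] k) ⊗[K] (A ⊗[K] k)) ∈ B2 K (A ⊗[K] k) →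
      ((uProj K A k P pk t : ↥(lambda2 K (A ⊗[K] k))) : (A ⊗[K] k) ⊗[K] (A ⊗[K] k)) ∈
        B2 K (A ⊗[K] k)) ∧
    ∃ fu : ↥(lambda2 K (A ⊗[K] k)) →ₗ[K] H2hom K A k,
      (∀ t : ↥(lambda2 K (A ⊗[K] k)),
        ((fu t : H2hom K A k) : ((A ⊗[K] k) ⊗[K] (A ⊗[K] k)) ⧸ B2 K (A ⊗[K] k)) =
          (B2 K (A ⊗[K] k)).mkQ
            ((uProj K A k P pk t : ↥(lambda2 K (A ⊗[K] k))) :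
              (A ⊗[K] k) ⊗[K] (A ⊗[K] k))) ∧
      ∀ (z : Type u₄) [AddCommGroup z] [Module K z],
        (∀ φ : H2hom K A k →ₗ[K] z, ∀ t : ↥(lambda2 K (A ⊗[K] k)),
          (t : (A ⊗[K] k) ⊗[K] (A ⊗[K] k)) ∈ B2 K (A ⊗[K] k) → φ (fu t) = 0) ∧
        (∀ φ ψ : H2hom K A k →ₗ[K] z,
          (∃ ℓ : (A ⊗[K] k) →ₗ[K] z, ∀ u v : A ⊗[K] k,
            φ (fu ⟨wedge K (A ⊗[K] k) u v, wedge_mem K u v⟩) -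
              ψ (fu ⟨wedge K (A ⊗[K] k) u v, wedge_mem K u v⟩) = -ℓ ⁅u, v⁆) → φ = ψ) ∧
        (∀ F : ↥(lambda2 K (A ⊗[K] k)) →ₗ[K] z,
          (∀ t : ↥(lambda2 K (A ⊗[K] k)),
            (t : (A ⊗[K] k) ⊗[K] (A ⊗[K] k)) ∈ B2 K (A ⊗[K] k) → F t = 0) →
          ∃ (φ : H2hom K A k →ₗ[K] z) (ℓ : (A ⊗[K] k) →ₗ[K] z),
            ∀ u v : A ⊗[K] k,
              F ⟨wedge K (A ⊗[K] k) u v, wedge_mem K u v⟩ =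
                φ (fu ⟨wedge K (A ⊗[K] k) u v, wedge_mem K u v⟩) + -ℓ ⁅u, v⁆) := by
  obtain ⟨σ, hσ⟩ := exists_uProj_add_eq K A k P hP pk hpk2
  have hmem : ∀ t, (uProj K A k P pk t : (A ⊗[K] k) ⊗[K] (A ⊗[K] k)) ∈ Z2g K A k := fun t =>
    ⟨(uProj K A k P pk t).2, gBracket_uProj K A k P hP pk hpk1 t⟩
  have hfix : ∀ t : ↥(lambda2 K (A ⊗[K] k)),
      (t : (A ⊗[K] k) ⊗[K] (A ⊗[K] k)) ∈ Z2g K A k → uProj K A k P pk t = t := fun t ht => by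
    have h := hσ t
    rwa [LinearMap.mem_ker.mp ht.2, map_zero, add_zero] at h
  have hB : ∀ t : ↥(lambda2 K (A ⊗[K] k)),
      (t : (A ⊗[K] k) ⊗[K] (A ⊗[K] k)) ∈ B2 K (A ⊗[K] k) →
      (uProj K A k P pk t : (A ⊗[K] k) ⊗[K] (A ⊗[K] k)) ∈ B2 K (A ⊗[K] k) := fun t ht => by
    rwa [hfix t (B2_le_Z2g K A k ht)]
  let fu : ↥(lambda2 K (A ⊗[K] k)) →ₗ[K] H2hom K A k :=
    ((B2 K (A ⊗[K] k)).mkQ.comp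
      ((lambda2 K (A ⊗[K] k)).subtype.comp (uProj K A k P pk))).codRestrict _
        fun t => Submodule.mem_map_of_mem (hmem t)
  have hfu : ∀ t, ((fu t : H2hom K A k) : ((A ⊗[K] k) ⊗[K] (A ⊗[K] k)) ⧸ B2 K (A ⊗[K] k)) =
      (B2 K (A ⊗[K] k)).mkQ (uProj K A k P pk t) := fun t => rfl
  have hfu_zero : ∀ t, fu t = 0 ↔
      (uProj K A k P pk t : (A ⊗[K] k) ⊗[K] (A ⊗[K] k)) ∈ B2 K (A ⊗[K] k) := fun t => by
    rw [← Submodule.coe_eq_zero, hfu, Submodule.mkQ_apply, Submodule.Quotient.mk_eq_zero]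
  refine ⟨hmem, hfix, hB, fu, hfu, fun z _ _ => ⟨fun φ t ht => ?_, ?_, fun F hF => ?_⟩⟩
  · rw [(hfu_zero t).mpr (hB t ht), map_zero]
  · rintro φ ψ ⟨ℓ, hℓ⟩
    have h : (φ - ψ).comp fu =
        -(ℓ.comp ((gBracket K A k).comp (lambda2 K (A ⊗[K] k)).subtype)) :=
      lambda2_hom_ext K fun u v => by
        simpa [gBracket_wedge] using hℓ u v
    ext ⟨_, t, ht, rfl⟩
    have h1 : fu ⟨t, ht.1⟩ = ⟨(B2 K (A ⊗[K] k)).mkQ t, Submodule.mem_map_of_mem ht⟩ :=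
      Subtype.ext (by rw [hfu, hfix ⟨t, ht.1⟩ ht])
    have h2 := LinearMap.congr_fun h ⟨t, ht.1⟩
    have h3 : gBracket K A k t = 0 := ht.2
    simp only [LinearMap.comp_apply, h1, LinearMap.sub_apply, LinearMap.neg_apply,
      Submodule.subtype_apply, h3, map_zero, neg_zero] at h2
    exact sub_eq_zero.mp h2
  · obtain ⟨φ, hφ⟩ := exists_eq_comp_of_ker_le K fu (F.comp (uProj K A k P pk))
      fun t ht => hF _ ((hfu_zero t).mp (LinearMap.mem_ker.mp ht))
    refine ⟨φ, -(F.comp σ), fun u v => ?_⟩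
    have h := congrArg F (hσ ⟨wedge K (A ⊗[K] k) u v, wedge_mem K u v⟩)
    rw [map_add, gBracket_wedge] at h
    rw [← hφ, LinearMap.neg_apply, neg_neg]
    exact h.symm

end CurrentPaper
end

section
/- The sequence {0} → H²(g/g')_{1,3} ⊕ Lin(A, H²(k)) →Φ H²(g) →Ψ Lin((Ω¹(A), d_A(A)), (Z³(k)_Γ, B³(k)_Γ)) → {0} is exact: Φ is injective, ker Ψ = im Φ, and Ψ is surjective. Here Ψ([f]), for a 2-cocycle f = f₁∘p₁ + f₂∘p₂ + f₃∘p₃, is the well-defined linear map Ω¹(A) ≅ Λ²(A)/T₀(A) → Z³(k) induced by a∧b ↦ Γ(f̃₁(a,b)) (which maps d_A(A) into B³(k)_Γ), and Φ sends (h,ψ) to the class of the pull-back of h along g → g/g' plus the class of f₂∘p₂ for any linear lift f̃₂: A → Z²(k) of ψ. -/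
set_option linter.unusedSectionVars false
set_option synthInstance.maxHeartbeats 1000000
set_option maxHeartbeats 1000000
open scoped TensorProduct

namespace CurrentPaper

variable (K : Type*) [Field K] [CharZero K]
variable (A : Type*) [CommRing A] [Algebra K A]
variable (k : Type*) [LieRing k] [LieAlgebra K k]

/-- The commutator ideal `k' = [k,k]` of `k`. -/
noncomputable def commIdeal : LieIdeal K k := ⁅(⊤ : LieIdeal K k), (⊤ : LieIdeal K k)⁆

/-- The abelianization `k/k'`. -/
noncomputable abbrev kAb := k ⧸ commIdeal K k

/-- The quotient map `k → k/k'` as a linear map. -/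
noncomputable def kAbMap : k →ₗ[K] kAb K k :=
  (LieSubmodule.Quotient.mk' (commIdeal K k)).toLinearMap

/-- The quotient map `g → g/g' ≅ A ⊗ (k/k')` as a linear map. -/
noncomputable def gAbMap : (A ⊗[K] k) →ₗ[K] (A ⊗[K] kAb K k) :=
  TensorProduct.map LinearMap.id (kAbMap K k)

section Cocycles

variable (L : Type*) [LieRing L] [Module K L]

/-- The space `Z²(L) = Z²(L,K)` of `K`-valued 2-cocycles on `L`, realized as linear
forms on `Λ²(L)` vanishing on `B₂(L)`. -/
noncomputable def Zc2 : Submodule K (↥(lambda2 K L) →ₗ[K] K) where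
  carrier := {f | ∀ t : ↥(lambda2 K L), (t : L ⊗[K] L) ∈ B2 K L → f t = 0}
  add_mem' := by
    intro f g hf hg t ht
    simp [LinearMap.add_apply, hf t ht, hg t ht]
  zero_mem' := by intro t ht; rfl
  smul_mem' := by
    intro c f hf t ht
    simp [LinearMap.smul_apply, hf t ht]

/-- The space `B²(L) = B²(L,K)` of `K`-valued 2-coboundaries on `L`. -/
noncomputable def Bc2 : Submodule K (↥(lambda2 K L) →ₗ[K] K) where
  carrier := {f | ∃ ℓ : L →ₗ[K] K, ∀ u v : L,
    f ⟨wedge K L u v, wedge_mem K u v⟩ = -ℓ ⁅u, v⁆}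
  add_mem' := by
    rintro f g ⟨lf, hf⟩ ⟨lg, hg⟩
    exact ⟨lf + lg, fun u v => by
      simp only [LinearMap.add_apply, hf u v, hg u v]; ring⟩
  zero_mem' := ⟨0, by simp⟩
  smul_mem' := by
    rintro c f ⟨l, hl⟩
    exact ⟨c • l, fun u v => by
      simp only [LinearMap.smul_apply, hl u v, smul_neg]⟩

/-- The second cohomology `H²(L) = Z²(L)/B²(L)`, realized as the image of `Z²(L)` in
the quotient of all linear forms on `Λ²(L)` by `B²(L)`. -/
noncomputable abbrev H2coh := ↥(Submodule.map (Bc2 K L).mkQ (Zc2 K L))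

end Cocycles

/-- The cocycle `Φ(h, f̃₂) = (pull-back of h along g → g/g') + f₂∘p₂`. -/
noncomputable def PhiCocycle (P : ↥(lambda2 K (A ⊗[K] k)) ≃ₗ[K] Wspace K A k)
    (h : (A ⊗[K] kAb K k) →ₗ[K] (A ⊗[K] kAb K k) →ₗ[K] K)
    (ft2 : A →ₗ[K] ↥(Zc2 K k)) : ↥(lambda2 K (A ⊗[K] k)) →ₗ[K] K :=
  ((TensorProduct.lift h).comp
      ((TensorProduct.map (gAbMap K A k) (gAbMap K A k)).comp
        (lambda2 K (A ⊗[K] k)).subtype)) +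
  ((TensorProduct.lift ((Zc2 K k).subtype.comp ft2)).comp
      ((LinearMap.fst K (M2 K A k) (M3 K A k)).comp
        ((LinearMap.snd K (M1 K A k) (M2 K A k × M3 K A k)).comp P.toLinearMap)))

/-- The predicate "`τ` lies in `Z³(k)_Γ = im Γ`", i.e. `τ = Γ(κ)` for some invariant
symmetric bilinear form `κ` on `k`. -/
def InImGamma (τ : k →ₗ[K] k →ₗ[K] k →ₗ[K] K) : Prop :=
  ∃ κ : k →ₗ[K] k →ₗ[K] K, (∀ x y : k, κ x y = κ y x) ∧
    (∀ x y w : k, κ ⁅x, y⁆ w = κ x ⁅y, w⁆) ∧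
    ∀ x y w : k, τ x y w = κ ⁅x, y⁆ w

/-- The predicate "`τ` lies in `B³(k)_Γ = B³(k) ∩ im Γ`". -/
def InB3Gamma (τ : k →ₗ[K] k →ₗ[K] k →ₗ[K] K) : Prop :=
  InImGamma K k τ ∧
    ∃ η : k →ₗ[K] k →ₗ[K] K, (∀ x : k, η x x = 0) ∧
      ∀ x y w : k, τ x y w = -(η ⁅x, y⁆ w) - η ⁅y, w⁆ x - η ⁅w, x⁆ y

/-- The value of `Γ ∘ f̃₁`, where `f₁` is the first component of the cocycle `F`;
`(Γ ∘ f̃₁)(a,b)(x,y,w) = f₁(a ∧ b ⊗ [x,y] ∨ w)`. -/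
noncomputable def gammaF (P : ↥(lambda2 K (A ⊗[K] k)) ≃ₗ[K] Wspace K A k)
    (F : ↥(lambda2 K (A ⊗[K] k)) →ₗ[K] K) (a b : A) (x y w : k) : K :=
  F (P.symm
    ((⟨wedge K A a b, wedge_mem K a b⟩ ⊗ₜ[K] ⟨vee K k ⁅x, y⁆ w, vee_mem K _ _⟩ : M1 K A k),
     (0 : M2 K A k), (0 : M3 K A k)))

section Helpers

variable {K A k}

section Forms

variable {V : Type*} [AddCommGroup V] [Module K V]

lemma wedge_add_left (u v w : V) : wedge K V (u + v) w = wedge K V u w + wedge K V v w := by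
  simp only [wedge, TensorProduct.add_tmul, TensorProduct.tmul_add, ← smul_add]
  congr 1; abel

lemma wedge_smul_left (c : K) (u w : V) : wedge K V (c • u) w = c • wedge K V u w := by
  rw [wedge, wedge, TensorProduct.tmul_smul, ← TensorProduct.smul_tmul', ← smul_sub, smul_comm]

lemma wedge_swap (u v : V) : wedge K V u v = -wedge K V v u := by
  simp only [wedge, ← smul_neg, neg_sub]

lemma wedge_add_right (u v w : V) : wedge K V u (v + w) = wedge K V u v + wedge K V u w := by
  rw [wedge_swap, wedge_add_left, neg_add, ← wedge_swap, ← wedge_swap]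

lemma wedge_smul_right (c : K) (u w : V) : wedge K V u (c • w) = c • wedge K V u w := by
  rw [wedge_swap, wedge_smul_left, ← smul_neg, ← wedge_swap]

lemma vee_swap (u v : V) : vee K V u v = vee K V v u := by
  simp only [vee, add_comm]

/-- The alternating bilinear form `(u,v) ↦ F(u ∧ v)` attached to a linear form on `Λ²(V)`. -/
noncomputable def wedgeForm (F : ↥(lambda2 K V) →ₗ[K] K) : V →ₗ[K] V →ₗ[K] K :=
  LinearMap.mk₂ K (fun u v => F ⟨wedge K V u v, wedge_mem K u v⟩)
    (fun u v w => by rw [← map_add]; congr 1; exact Subtype.ext (wedge_add_left u v w))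
    (fun c u w => by rw [← map_smul]; congr 1; exact Subtype.ext (wedge_smul_left c u w))
    (fun u v w => by rw [← map_add]; congr 1; exact Subtype.ext (wedge_add_right u v w))
    (fun c u w => by rw [← map_smul]; congr 1; exact Subtype.ext (wedge_smul_right c u w))

lemma wedgeForm_apply (F : ↥(lambda2 K V) →ₗ[K] K) (u v : V) :
    wedgeForm F u v = F ⟨wedge K V u v, wedge_mem K u v⟩ := rfl

lemma wedgeForm_swap (F : ↥(lambda2 K V) →ₗ[K] K) (u v : V) :
    wedgeForm F u v = -wedgeForm F v u := by
  rw [wedgeForm_apply, wedgeForm_apply, ← map_neg]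
  congr 1; exact Subtype.ext (wedge_swap u v)

/-- Restriction of a linear form on `V ⊗ V` to `Λ²(V)`, evaluated on `u ∧ v`. -/
lemma restrict_wedge (G : V ⊗[K] V →ₗ[K] K) (hG : ∀ u v, G (u ⊗ₜ v) = -G (v ⊗ₜ u)) (u v : V) :
    (G.comp (lambda2 K V).subtype) ⟨wedge K V u v, wedge_mem K u v⟩ = G (u ⊗ₜ v) := by
  simp only [LinearMap.comp_apply, Submodule.subtype_apply, wedge, map_smul, map_sub, smul_eq_mul,
    hG v u]
  ring

/-- An alternating bilinear form is antisymmetric. -/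
lemma form_swap {φ : V →ₗ[K] V →ₗ[K] K} (hφ : ∀ u, φ u u = 0) (u v : V) : φ u v = -φ v u := by
  have h := hφ (u + v)
  simp only [map_add, LinearMap.add_apply, hφ, zero_add, add_zero] at h
  linear_combination h

end Forms

section Cocycle

variable {L : Type*} [LieRing L] [Module K L]

lemma mem_Zc2_iff (F : ↥(lambda2 K L) →ₗ[K] K) :
    F ∈ Zc2 K L ↔ ∀ u v w : L,
      wedgeForm F ⁅u, v⁆ w + wedgeForm F ⁅v, w⁆ u + wedgeForm F ⁅w, u⁆ v = 0 := by
  have key : ∀ u v w : L, F ⟨dd K L u v w, dd_mem_lambda2 K u v w⟩ =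
      wedgeForm F ⁅u, v⁆ w + wedgeForm F ⁅v, w⁆ u + wedgeForm F ⁅w, u⁆ v := by
    intro u v w
    simp only [wedgeForm_apply, ← map_add]
    rfl
  constructor
  · intro hF u v w
    rw [← key]
    exact hF _ (dd_mem_B2 K u v w)
  · intro h t ht
    have hle : B2 K L ≤ (LinearMap.ker F).map (lambda2 K L).subtype := by
      refine Submodule.span_le.mpr ?_
      rintro _ ⟨u, v, w, rfl⟩
      exact ⟨⟨dd K L u v w, dd_mem_lambda2 K u v w⟩, by
        simpa [LinearMap.mem_ker, key] using h u v w, rfl⟩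
    obtain ⟨s, hs, hst⟩ := hle ht
    rw [← Subtype.ext (a1 := s) (a2 := t) hst]
    exact hs

end Cocycle

/-- `(a,b,x,y) ↦ F(ax ∧ by)` as a multilinear map. -/
noncomputable def pureForm (F : ↥(lambda2 K (A ⊗[K] k)) →ₗ[K] K) :
    A →ₗ[K] A →ₗ[K] k →ₗ[K] k →ₗ[K] K :=
  LinearMap.mk₂ K
    (fun a b => (wedgeForm F).compl₁₂ (TensorProduct.mk K A k a) (TensorProduct.mk K A k b))
    (fun a b c => by ext; simp) (fun a b c => by ext; simp)
    (fun a b c => by ext; simp) (fun a b c => by ext; simp)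

lemma pureForm_apply (F : ↥(lambda2 K (A ⊗[K] k)) →ₗ[K] K) (a b : A) (x y : k) :
    pureForm F a b x y = wedgeForm F (a ⊗ₜ x) (b ⊗ₜ y) := rfl

lemma pureForm_swap (F : ↥(lambda2 K (A ⊗[K] k)) →ₗ[K] K) (a b : A) (x y : k) :
    pureForm F a b x y = -pureForm F b a y x := by
  simp only [pureForm_apply]; exact wedgeForm_swap _ _ _

/-- The cocycle identity for a multilinear form, on pure tensors of `A ⊗ k`. -/
def IsPureCocycle (T : A →ₗ[K] A →ₗ[K] k →ₗ[K] k →ₗ[K] K) : Prop :=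
  ∀ (a b c : A) (x y z : k),
    T (a * b) c ⁅x, y⁆ z + T (b * c) a ⁅y, z⁆ x + T (c * a) b ⁅z, x⁆ y = 0

lemma mem_Zc2_iff_pure (F : ↥(lambda2 K (A ⊗[K] k)) →ₗ[K] K) :
    F ∈ Zc2 K (A ⊗[K] k) ↔ IsPureCocycle (pureForm F) := by
  rw [mem_Zc2_iff]
  constructor
  · intro h a b c x y z
    simpa [pureForm_apply, LieAlgebra.ExtendScalars.bracket_tmul]
      using h (a ⊗ₜ x) (b ⊗ₜ y) (c ⊗ₜ z)
  · intro h u v w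
    induction u using TensorProduct.induction_on with
    | zero => simp
    | add u u' hu hu' =>
      simp only [add_lie, lie_add, map_add, LinearMap.add_apply] at *
      linear_combination hu + hu'
    | tmul a x =>
      induction v using TensorProduct.induction_on with
      | zero => simp
      | add u u' hu hu' =>
        simp only [add_lie, lie_add, map_add, LinearMap.add_apply] at *
        linear_combination hu + hu'
      | tmul b y =>
        induction w using TensorProduct.induction_on with
        | zero => simp
        | add u u' hu hu' =>
          simp only [add_lie, lie_add, map_add, LinearMap.add_apply] at *
          linear_combination hu + hu'
        | tmul c z =>
          simpa [pureForm_apply, LieAlgebra.ExtendScalars.bracket_tmul] using h a b c x y z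

lemma gammaF_eq {P : ↥(lambda2 K (A ⊗[K] k)) ≃ₗ[K] Wspace K A k} (hP : IsDecomposition K P)
    (F : ↥(lambda2 K (A ⊗[K] k)) →ₗ[K] K) (a b : A) (x y w : k) :
    gammaF K A k P F a b x y w
      = (2 : K)⁻¹ * (pureForm F a b ⁅x, y⁆ w + pureForm F a b w ⁅x, y⁆) := by
  have h2 : (2 : K)⁻¹ + (2 : K)⁻¹ = 1 := by norm_num
  simp only [pureForm_apply, wedgeForm_apply, gammaF, ← map_add, ← smul_eq_mul, ← map_smul]
  congr 1
  rw [LinearEquiv.symm_apply_eq, map_smul, map_add, hP, hP]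
  have e1 : (⟨vee K k w ⁅x, y⁆, vee_mem K _ _⟩ : sym2 K k) = ⟨vee K k ⁅x, y⁆ w, vee_mem K _ _⟩ :=
    Subtype.ext (vee_swap _ _)
  have e2 : (⟨wedge K k w ⁅x, y⁆, wedge_mem K _ _⟩ : lambda2 K k)
      = -⟨wedge K k ⁅x, y⁆ w, wedge_mem K _ _⟩ := Subtype.ext (wedge_swap _ _)
  rw [e1, e2]
  rw [TensorProduct.tmul_neg, TensorProduct.tmul_neg, Prod.mk_add_mk, Prod.mk_add_mk,
    add_neg_cancel (G := M2 K A k), add_neg_cancel (G := M3 K A k), Prod.smul_mk, Prod.smul_mk,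
    smul_zero, smul_zero, smul_add, ← add_smul, h2, one_smul]

section Core

variable {T : A →ₗ[K] A →ₗ[K] k →ₗ[K] k →ₗ[K] K}

lemma IsPureCocycle.row_diff_cyclic (hT : IsPureCocycle T) (a b c : A) (x y z : k) :
    T (b * c) a ⁅y, z⁆ x - T (a * c) b ⁅y, z⁆ x = T (b * c) a ⁅z, x⁆ y - T (a * c) b ⁅z, x⁆ y := by
  have h1 := hT a b c x y z
  have h2 := hT b a c x y z
  rw [mul_comm c a] at h1
  rw [mul_comm b a, mul_comm c b] at h2
  linear_combination h1 - h2

/-- The cyclic sum `T(a,b)([x,y],z) + T(a,b)([y,z],x) + T(a,b)([z,x],y)`. -/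
def cyclicSum (T : A →ₗ[K] A →ₗ[K] k →ₗ[K] k →ₗ[K] K) (x y z : k) (a b : A) : K :=
  T a b ⁅x, y⁆ z + T a b ⁅y, z⁆ x + T a b ⁅z, x⁆ y

lemma IsPureCocycle.cyclicSum_eq_zero (hT : IsPureCocycle T) (a b c : A) (x y z : k) :
    cyclicSum T x y z (a * b) c + cyclicSum T x y z (b * c) a + cyclicSum T x y z (c * a) b
      = 0 := by
  have h1 := hT a b c x y z
  have h2 := hT a b c y z x
  have h3 := hT a b c z x y
  simp only [cyclicSum]
  linear_combination h1 + h2 + h3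

/-- Twice the antisymmetrization of `T` in the `A`-variables. -/
noncomputable def antisymPart (T : A →ₗ[K] A →ₗ[K] k →ₗ[K] k →ₗ[K] K) :
    A →ₗ[K] A →ₗ[K] k →ₗ[K] k →ₗ[K] K :=
  LinearMap.mk₂ K (fun a b => T a b - T b a)
    (fun a b c => by simp only [map_add, LinearMap.add_apply]; abel)
    (fun c a b => by
      ext; simp only [map_smul, LinearMap.smul_apply, LinearMap.sub_apply, smul_sub])
    (fun a b c => by simp only [map_add, LinearMap.add_apply]; abel)
    (fun c a b => by
      ext; simp only [map_smul, LinearMap.smul_apply, LinearMap.sub_apply, smul_sub])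

lemma antisymPart_apply (a b : A) (x y : k) :
    antisymPart T a b x y = T a b x y - T b a x y := rfl

lemma antisymPart_eq_add (hs : ∀ a b x y, T a b x y = -T b a y x) (a b : A) (x y : k) :
    antisymPart T a b x y = T a b x y + T a b y x := by
  rw [antisymPart_apply, hs b a]; ring

lemma antisymPart_symm (hs : ∀ a b x y, T a b x y = -T b a y x) (a b : A) (x y : k) :
    antisymPart T a b x y = antisymPart T a b y x := by
  rw [antisymPart_eq_add hs, antisymPart_eq_add hs]; ring

lemma antisymPart_swap (a b : A) (x y : k) :
    antisymPart T a b x y = -antisymPart T b a x y := by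
  simp only [antisymPart_apply]; ring

lemma IsPureCocycle.antisymPart_cyclic (hT : IsPureCocycle T) (a b : A) (x y z : k) :
    antisymPart T a b ⁅x, y⁆ z = antisymPart T a b ⁅y, z⁆ x := by
  have h := hT.row_diff_cyclic b a 1 z x y
  simpa only [mul_one, antisymPart_apply] using h

lemma IsPureCocycle.three_mul_antisymPart (hT : IsPureCocycle T) (a b : A) (x y z : k) :
    3 * antisymPart T a b ⁅x, y⁆ z
      = 2 * cyclicSum T x y z a b + cyclicSum T x y z (a * b) 1 := by
  have h1 := hT.antisymPart_cyclic a b x y z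
  have h2 := hT.antisymPart_cyclic a b y z x
  have h3 := hT.cyclicSum_eq_zero a b 1 x y z
  simp only [antisymPart_apply] at *
  simp only [mul_one, one_mul, cyclicSum] at *
  linear_combination 2 * h1 + h2 - h3

lemma IsPureCocycle.antisymPart_T0 (hT : IsPureCocycle T) (a b c : A) (x y z : k) :
    antisymPart T (a * b) c ⁅x, y⁆ z + antisymPart T (b * c) a ⁅x, y⁆ z
      + antisymPart T (c * a) b ⁅x, y⁆ z = antisymPart T (a * b * c) 1 ⁅x, y⁆ z := by
  have h1 := hT.three_mul_antisymPart (a * b) c x y z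
  have h2 := hT.three_mul_antisymPart (b * c) a x y z
  have h3 := hT.three_mul_antisymPart (c * a) b x y z
  have h4 := hT.three_mul_antisymPart (a * b * c) 1 x y z
  have h5 := hT.cyclicSum_eq_zero a b c x y z
  rw [show b * c * a = a * b * c by ring] at h2
  rw [show c * a * b = a * b * c by ring] at h3
  rw [mul_one] at h4
  refine mul_left_cancel₀ (three_ne_zero (α := K)) ?_
  linear_combination h1 + h2 + h3 - h4 + 2 * h5

/-- If the antisymmetric part is killed by brackets, scalars move between the two slots. -/
lemma IsPureCocycle.move_of_antisymPart_eq_zero (hT : IsPureCocycle T)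
    (h0 : ∀ (a b : A) (x y z : k), antisymPart T a b ⁅x, y⁆ z = 0) (a b : A) (x y z : k) :
    T a b ⁅x, y⁆ z = T (a * b) 1 ⁅x, y⁆ z ∧ cyclicSum T x y z a b = 0 := by
  have e1 := hT.three_mul_antisymPart (a * b) 1 x y z
  have e2 := hT.three_mul_antisymPart a b x y z
  rw [h0, mul_one] at e1
  rw [h0] at e2
  have e1' : cyclicSum T x y z (a * b) 1 = 0 := by
    refine mul_left_cancel₀ (three_ne_zero (α := K)) ?_
    linear_combination -e1
  have e2' : cyclicSum T x y z a b = 0 := by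
    refine mul_left_cancel₀ (two_ne_zero (α := K)) ?_
    linear_combination -e2 - e1'
  refine ⟨?_, e2'⟩
  have r1 := hT.row_diff_cyclic 1 b a z x y
  have r2 := hT.row_diff_cyclic 1 b a x y z
  rw [one_mul, mul_comm b a] at r1 r2
  simp only [cyclicSum] at e1' e2'
  refine mul_left_cancel₀ (three_ne_zero (α := K)) ?_
  linear_combination e2' - e1' - 2 * r1 - r2

end Core

set_option maxSynthPendingDepth 10

section Kaehler

variable {W : Type*} [AddCommGroup W] [Module K W]

/-- A bilinear map `B` with `B(a,bc) = B(ab,c) + B(ac,b)` factors through `a ⊗ b ↦ a • d b`. -/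
lemma exists_kaehler_lift (B : A →ₗ[K] A →ₗ[K] W)
    (hB : ∀ a b c, B a (b * c) = B (a * b) c + B (a * c) b) :
    ∃ β : Ω[A⁄K] →ₗ[K] W, ∀ a b, β (a • KaehlerDifferential.D K A b) = B a b := by
  let _ : Module A (A →ₗ[K] W) :=
    { smul := fun c φ => φ ∘ₗ LinearMap.mulLeft K c
      one_smul := fun φ => LinearMap.ext fun a => congrArg φ (one_mul a)
      mul_smul := fun c d φ => LinearMap.ext fun a =>
        congrArg φ (show c * d * a = d * (c * a) by ring)
      smul_zero := fun c => rfl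
      smul_add := fun c φ ψ => rfl
      add_smul := fun c d φ => LinearMap.ext fun a =>
        (congrArg φ (add_mul c d a)).trans (map_add φ _ _)
      zero_smul := fun φ => LinearMap.ext fun a =>
        (congrArg φ (zero_mul a)).trans (map_zero φ) }
  have smul_def : ∀ (c : A) (φ : A →ₗ[K] W) (a : A), (c • φ) a = φ (c * a) := fun _ _ _ => rfl
  have : IsScalarTower K A (A →ₗ[K] W) :=
    ⟨fun r c φ => LinearMap.ext fun a => by
      rw [smul_def, LinearMap.smul_apply, smul_def, smul_mul_assoc, map_smul]⟩
  let D : Derivation K A (A →ₗ[K] W) := Derivation.mk' B.flip fun b c => LinearMap.ext fun a => by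
    simp only [LinearMap.add_apply, smul_def, LinearMap.flip_apply]
    rw [hB, mul_comm a b, mul_comm a c]
  refine ⟨LinearMap.applyₗ (1 : A) ∘ₗ D.liftKaehlerDifferential.restrictScalars K, fun a b => ?_⟩
  simp only [LinearMap.comp_apply, LinearMap.coe_restrictScalars, map_smul,
    Derivation.liftKaehlerDifferential_comp_D]
  change (a • D b) 1 = B a b
  rw [smul_def, mul_one]
  rfl

end Kaehler

/-- The set of trilinear forms in the image of the Koszul map, as a submodule. -/
def imGamma (K k : Type*) [Field K] [CharZero K] [LieRing k] [LieAlgebra K k] :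
    Submodule K (k →ₗ[K] k →ₗ[K] k →ₗ[K] K) where
  carrier := {τ | InImGamma K k τ}
  add_mem' := by
    rintro _ _ ⟨κ, h1, h2, h3⟩ ⟨κ', h1', h2', h3'⟩
    exact ⟨κ + κ', fun x y => by simp [h1 x y, h1' x y], fun x y w => by simp [h2, h2'],
      fun x y w => by simp [h3, h3']⟩
  zero_mem' := ⟨0, by simp, by simp, by simp⟩
  smul_mem' := by
    rintro c _ ⟨κ, h1, h2, h3⟩
    exact ⟨c • κ, fun x y => by simp [h1 x y], fun x y w => by simp [h2],
      fun x y w => by simp [h3]⟩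

/-- Composition of the first slot of a bilinear form with the bracket: `κ ↦ κ([x,y],w)`. -/
noncomputable def koszul (K k : Type*) [Field K] [CharZero K] [LieRing k] [LieAlgebra K k] :
    (k →ₗ[K] k →ₗ[K] K) →ₗ[K] (k →ₗ[K] k →ₗ[K] k →ₗ[K] K) where
  toFun κ := ((LieModule.toEnd K k k : k →ₗ[K] Module.End K k)).compr₂ κ
  map_add' _ _ := rfl
  map_smul' _ _ := rfl

lemma koszul_apply (κ : k →ₗ[K] k →ₗ[K] K) (x y w : k) :
    koszul K k κ x y w = κ ⁅x, y⁆ w := rfl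

lemma exists_kaehler_of_cocycle {P : ↥(lambda2 K (A ⊗[K] k)) ≃ₗ[K] Wspace K A k}
    (hP : IsDecomposition K P) (F : ↥(lambda2 K (A ⊗[K] k)) →ₗ[K] K)
    (hF : F ∈ Zc2 K (A ⊗[K] k)) :
    ∃ β : Ω[A⁄K] →ₗ[K] (k →ₗ[K] k →ₗ[K] k →ₗ[K] K),
      (∀ (a b : A) (x y w : k),
        β (a • KaehlerDifferential.D K A b - b • KaehlerDifferential.D K A a) x y w =
          gammaF K A k P F a b x y w) ∧
      (∀ ω : Ω[A⁄K], InImGamma K k (β ω)) ∧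
      (∀ a : A, InB3Gamma K k (β (KaehlerDifferential.D K A a))) := by
  rw [mem_Zc2_iff_pure] at hF
  have hs := pureForm_swap F
  set T := pureForm F
  let κ : A →ₗ[K] A →ₗ[K] k →ₗ[K] k →ₗ[K] K :=
    LinearMap.mk₂ K (fun a b => (4 : K)⁻¹ • (antisymPart T a b - antisymPart T (a * b) 1))
      (fun a b c => by
        simp only [add_mul, map_add, LinearMap.add_apply, ← smul_add]; congr 1; abel)
      (fun c a b => by
        ext
        simp only [smul_mul_assoc, map_smul, LinearMap.smul_apply, LinearMap.sub_apply, smul_eq_mul]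
        ring)
      (fun a b c => by
        simp only [mul_add, map_add, LinearMap.add_apply, ← smul_add]; congr 1; abel)
      (fun c a b => by
        ext
        simp only [mul_smul_comm, map_smul, LinearMap.smul_apply, LinearMap.sub_apply, smul_eq_mul]
        ring)
  have κ_apply : ∀ a b x y, κ a b x y
      = (4 : K)⁻¹ * (antisymPart T a b x y - antisymPart T (a * b) 1 x y) := fun _ _ _ _ => rfl
  obtain ⟨β, hβ⟩ := exists_kaehler_lift (κ.compr₂ (koszul K k)) (by
    intro a b c
    ext x y z
    simp only [LinearMap.compr₂_apply, LinearMap.add_apply, koszul_apply, κ_apply]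
    have h := hF.antisymPart_T0 a b c x y z
    have h1 := antisymPart_swap (T := T) a (b * c) ⁅x, y⁆ z
    rw [mul_comm c a] at h
    rw [show a * c * b = a * b * c by ring, ← mul_assoc, h1]
    linear_combination (-(4 : K)⁻¹) * h)
  have hβ' : ∀ a b x y w, β (a • KaehlerDifferential.D K A b) x y w = κ a b ⁅x, y⁆ w := by
    intro a b x y w
    rw [hβ]; rfl
  have him : ∀ ω : Ω[A⁄K], InImGamma K k (β ω) := by
    intro ω
    have hω : ω ∈ Submodule.span A (Set.range (KaehlerDifferential.D K A)) := by
      rw [KaehlerDifferential.span_range_derivation]; trivial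
    have hmem : ∀ a : A, β (a • ω) ∈ imGamma K k := by
      induction hω using Submodule.span_induction with
      | zero => intro a; rw [smul_zero, map_zero]; exact zero_mem _
      | add x y _ _ hx hy => intro a; rw [smul_add, map_add]; exact add_mem (hx a) (hy a)
      | smul c x _ hx => intro a; rw [smul_smul]; exact hx _
      | mem x hx =>
        obtain ⟨b, rfl⟩ := hx
        intro a
        refine ⟨κ a b, fun x y => ?_, fun x y z => ?_, fun x y z => hβ' a b x y z⟩
        · rw [κ_apply, κ_apply, antisymPart_symm hs, antisymPart_symm hs (a * b)]
        · rw [κ_apply, κ_apply, hF.antisymPart_cyclic a b, hF.antisymPart_cyclic (a * b) 1,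
            antisymPart_symm hs a b, antisymPart_symm hs (a * b)]
    have h := hmem 1
    rwa [one_smul] at h
  refine ⟨β, ?_, him, ?_⟩
  · intro a b x y w
    have h := antisymPart_swap (T := T) b a ⁅x, y⁆ w
    rw [map_sub, LinearMap.sub_apply, LinearMap.sub_apply, LinearMap.sub_apply, hβ', hβ', κ_apply,
      κ_apply, gammaF_eq hP, ← antisymPart_eq_add hs, h, mul_comm b a]
    field_simp
    ring
  · intro a
    refine ⟨him _, (-(2 : K)⁻¹) • (T a 1 - (T a 1).flip), fun x => by simp, fun x y w => ?_⟩
    have h := hβ' 1 a x y w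
    rw [one_smul] at h
    rw [h, κ_apply, one_mul]
    have e1 := hF.three_mul_antisymPart a 1 x y w
    have e2 := hF.antisymPart_cyclic a 1 x y w
    have e3 := hF.antisymPart_cyclic a 1 y w x
    have e4 := antisymPart_swap (T := T) 1 a ⁅x, y⁆ w
    have s1 := antisymPart_eq_add hs a 1 ⁅x, y⁆ w
    have s2 := antisymPart_eq_add hs a 1 ⁅y, w⁆ x
    have s3 := antisymPart_eq_add hs a 1 ⁅w, x⁆ y
    rw [mul_one, cyclicSum] at e1
    simp only [LinearMap.smul_apply, LinearMap.sub_apply, LinearMap.flip_apply, smul_eq_mul]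
    rw [e4]
    field_simp
    linear_combination (-4 : K) * (s1 + s2 + s3) + 8 / 3 * e1 - 8 * e2 - 4 * e3

lemma kAbMap_lie (x y : k) : kAbMap K k ⁅x, y⁆ = 0 := by
  refine (LieSubmodule.Quotient.mk_eq_zero (N := commIdeal K k)).mpr ?_
  exact LieSubmodule.lie_mem_lie (LieSubmodule.mem_top x) (LieSubmodule.mem_top y)

lemma kAbMap_surjective : Function.Surjective (kAbMap K k) :=
  LieSubmodule.Quotient.surjective_mk' (commIdeal K k)

/-- A linear map killing all brackets kills the kernel of `k → k/k'`. -/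
lemma eq_zero_of_kAbMap_eq_zero {W : Type*} [AddCommMonoid W] [Module K W] (f : k →ₗ[K] W)
    (hf : ∀ x y : k, f ⁅x, y⁆ = 0) (x : k) (hx : kAbMap K k x = 0) : f x = 0 := by
  have hx' : x ∈ (commIdeal K k).toSubmodule :=
    (LieSubmodule.Quotient.mk_eq_zero (N := commIdeal K k)).mp hx
  rw [commIdeal, LieSubmodule.lieIdeal_oper_eq_linear_span'] at hx'
  have hle : Submodule.span K {⁅x, n⁆ | (x ∈ (⊤ : LieIdeal K k)) (n ∈ (⊤ : LieIdeal K k))}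
      ≤ LinearMap.ker f := by
    refine Submodule.span_le.mpr ?_
    rintro _ ⟨u, _, v, _, rfl⟩
    exact hf u v
  exact hle hx'

lemma gAbMap_tmul (a : A) (x : k) : gAbMap K A k (a ⊗ₜ x) = a ⊗ₜ kAbMap K k x := rfl

section Phi

variable {P : ↥(lambda2 K (A ⊗[K] k)) ≃ₗ[K] Wspace K A k}

lemma lift_zero_form {V W : Type*} [AddCommGroup V] [Module K V] [AddCommGroup W] [Module K W] :
    TensorProduct.lift (0 : V →ₗ[K] W →ₗ[K] K) = 0 :=
  TensorProduct.ext' fun _ _ => rfl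

lemma wedgeForm_PhiCocycle {h : (A ⊗[K] kAb K k) →ₗ[K] (A ⊗[K] kAb K k) →ₗ[K] K}
    (hh : ∀ u, h u u = 0) (ft2 : A →ₗ[K] ↥(Zc2 K k)) (u v : A ⊗[K] k) :
    wedgeForm (PhiCocycle K A k P h ft2) u v
      = h (gAbMap K A k u) (gAbMap K A k v) + wedgeForm (PhiCocycle K A k P 0 ft2) u v := by
  have e := restrict_wedge
    ((TensorProduct.lift h).comp (TensorProduct.map (gAbMap K A k) (gAbMap K A k)))
    (fun u v => by simpa using form_swap hh _ _) u v
  simp only [wedgeForm_apply, PhiCocycle, LinearMap.add_apply]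
  rw [lift_zero_form, LinearMap.zero_comp, LinearMap.zero_apply, zero_add]
  congr 1

lemma pureForm_PhiCocycle_zero (hP : IsDecomposition K P) (ft2 : A →ₗ[K] ↥(Zc2 K k))
    (a b : A) (x y : k) :
    pureForm (PhiCocycle K A k P 0 ft2) a b x y
      = wedgeForm (ft2 (a * b) : ↥(lambda2 K k) →ₗ[K] K) x y := by
  simp only [pureForm_apply, wedgeForm_apply, PhiCocycle, LinearMap.add_apply]
  rw [lift_zero_form, LinearMap.zero_comp, LinearMap.zero_apply, zero_add]
  simp only [LinearMap.comp_apply, LinearEquiv.coe_coe, hP a b x y, LinearMap.snd_apply,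
    LinearMap.fst_apply, TensorProduct.lift.tmul, Submodule.subtype_apply]

lemma pureForm_PhiCocycle (hP : IsDecomposition K P)
    {h : (A ⊗[K] kAb K k) →ₗ[K] (A ⊗[K] kAb K k) →ₗ[K] K}
    (hh : ∀ u, h u u = 0) (ft2 : A →ₗ[K] ↥(Zc2 K k)) (a b : A) (x y : k) :
    pureForm (PhiCocycle K A k P h ft2) a b x y
      = h (a ⊗ₜ kAbMap K k x) (b ⊗ₜ kAbMap K k y)
        + wedgeForm (ft2 (a * b) : ↥(lambda2 K k) →ₗ[K] K) x y := by
  rw [← pureForm_PhiCocycle_zero hP, pureForm_apply, wedgeForm_PhiCocycle hh]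
  rfl

lemma PhiCocycle_mem (hP : IsDecomposition K P)
    {h : (A ⊗[K] kAb K k) →ₗ[K] (A ⊗[K] kAb K k) →ₗ[K] K}
    (hh : ∀ u, h u u = 0) (ft2 : A →ₗ[K] ↥(Zc2 K k)) :
    PhiCocycle K A k P h ft2 ∈ Zc2 K (A ⊗[K] k) := by
  rw [mem_Zc2_iff_pure]
  intro a b c x y z
  simp only [pureForm_PhiCocycle hP hh, kAbMap_lie, TensorProduct.tmul_zero, map_zero,
    LinearMap.zero_apply, zero_add]
  rw [show b * c * a = a * b * c by ring, show c * a * b = a * b * c by ring]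
  exact (mem_Zc2_iff _).mp (ft2 (a * b * c)).2 x y z

lemma PhiCocycle_injective (hP : IsDecomposition K P)
    {h : (A ⊗[K] kAb K k) →ₗ[K] (A ⊗[K] kAb K k) →ₗ[K] K}
    (hh : ∀ u, h u u = 0)
    (hsymm : ∀ (a : A) (x y : k),
        h (a ⊗ₜ[K] kAbMap K k x) ((1 : A) ⊗ₜ[K] kAbMap K k y) =
          h (a ⊗ₜ[K] kAbMap K k y) ((1 : A) ⊗ₜ[K] kAbMap K k x))
    (ft2 : A →ₗ[K] ↥(Zc2 K k)) (ℓ : (A ⊗[K] k) →ₗ[K] K)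
    (hℓ : ∀ u v : A ⊗[K] k, wedgeForm (PhiCocycle K A k P h ft2) u v = -ℓ ⁅u, v⁆) :
    h = 0 ∧ ∀ a : A, (Bc2 K k).mkQ ↑(ft2 a) = 0 := by
  have hpure : ∀ (a b : A) (x y : k), h (a ⊗ₜ kAbMap K k x) (b ⊗ₜ kAbMap K k y)
      + wedgeForm (ft2 (a * b) : ↥(lambda2 K k) →ₗ[K] K) x y = -ℓ ((a * b) ⊗ₜ ⁅x, y⁆) := by
    intro a b x y
    rw [← pureForm_PhiCocycle hP hh, pureForm_apply, hℓ,
      LieAlgebra.ExtendScalars.bracket_tmul]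
  have hft : ∀ (a : A) (x y : k),
      wedgeForm (ft2 a : ↥(lambda2 K k) →ₗ[K] K) x y = -ℓ (a ⊗ₜ ⁅x, y⁆) := by
    intro a x y
    have h1 := hpure a 1 x y
    have h2 := hpure a 1 y x
    rw [mul_one] at h1 h2
    rw [← lie_skew, TensorProduct.tmul_neg, map_neg, ← hsymm, wedgeForm_swap] at h2
    refine mul_left_cancel₀ (two_ne_zero (α := K)) ?_
    linear_combination h1 - h2
  constructor
  · refine TensorProduct.ext' fun a x => ?_
    refine TensorProduct.ext' fun b y => ?_
    obtain ⟨x, rfl⟩ := kAbMap_surjective x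
    obtain ⟨y, rfl⟩ := kAbMap_surjective y
    have h1 := hpure a b x y
    rw [hft] at h1
    simpa using h1
  · intro a
    rw [Submodule.mkQ_apply, Submodule.Quotient.mk_eq_zero]
    exact ⟨ℓ ∘ₗ TensorProduct.mk K A k a, fun x y => hft a x y⟩

lemma gammaF_eq_zero_of_sub (hP : IsDecomposition K P)
    (F : ↥(lambda2 K (A ⊗[K] k)) →ₗ[K] K)
    {h : (A ⊗[K] kAb K k) →ₗ[K] (A ⊗[K] kAb K k) →ₗ[K] K}
    (hh : ∀ u, h u u = 0) (ft2 : A →ₗ[K] ↥(Zc2 K k)) (ℓ : (A ⊗[K] k) →ₗ[K] K)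
    (hℓ : ∀ u v : A ⊗[K] k,
      wedgeForm F u v - wedgeForm (PhiCocycle K A k P h ft2) u v = -ℓ ⁅u, v⁆)
    (a b : A) (x y w : k) : gammaF K A k P F a b x y w = 0 := by
  have hpure : ∀ (a b : A) (x y : k), pureForm F a b x y
      = h (a ⊗ₜ kAbMap K k x) (b ⊗ₜ kAbMap K k y)
      + wedgeForm (ft2 (a * b) : ↥(lambda2 K k) →ₗ[K] K) x y - ℓ ((a * b) ⊗ₜ ⁅x, y⁆) := by
    intro a b x y
    rw [← pureForm_PhiCocycle hP hh, ← LieAlgebra.ExtendScalars.bracket_tmul]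
    simp only [pureForm_apply]
    linear_combination hℓ (a ⊗ₜ x) (b ⊗ₜ y)
  rw [gammaF_eq hP, hpure, hpure, kAbMap_lie, wedgeForm_swap _ w, ← lie_skew w ⁅x, y⁆,
    TensorProduct.tmul_neg, map_neg, TensorProduct.tmul_zero, map_zero, LinearMap.zero_apply,
    TensorProduct.tmul_zero, map_zero]
  ring

lemma exists_PhiCocycle_eq (hP : IsDecomposition K P)
    (F : ↥(lambda2 K (A ⊗[K] k)) →ₗ[K] K) (hF : F ∈ Zc2 K (A ⊗[K] k))
    (h0 : ∀ (a b : A) (x y w : k), gammaF K A k P F a b x y w = 0) :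
    ∃ h : (A ⊗[K] kAb K k) →ₗ[K] (A ⊗[K] kAb K k) →ₗ[K] K,
      (∀ u, h u u = 0) ∧
      (∀ (a : A) (x y : k),
        h (a ⊗ₜ[K] kAbMap K k x) ((1 : A) ⊗ₜ[K] kAbMap K k y) =
          h (a ⊗ₜ[K] kAbMap K k y) ((1 : A) ⊗ₜ[K] kAbMap K k x)) ∧
      ∃ ft2 : A →ₗ[K] ↥(Zc2 K k), ∀ u v : A ⊗[K] k,
        wedgeForm F u v = wedgeForm (PhiCocycle K A k P h ft2) u v := by
  rw [mem_Zc2_iff_pure] at hF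
  have hs := pureForm_swap F
  set T := pureForm F
  have hS : ∀ (a b : A) (x y z : k), antisymPart T a b ⁅x, y⁆ z = 0 := by
    intro a b x y z
    have h := h0 a b x y z
    rw [gammaF_eq hP, ← antisymPart_eq_add hs] at h
    simpa using h
  let f2 : A →ₗ[K] ↥(lambda2 K k) →ₗ[K] K :=
    { toFun := fun a => (TensorProduct.lift (T a 1)).comp (lambda2 K k).subtype
      map_add' := fun a b => by
        rw [← LinearMap.add_comp]; congr 1
        exact TensorProduct.ext' fun x y => by simp
      map_smul' := fun c a => by
        rw [RingHom.id_apply, ← LinearMap.smul_comp]; congr 1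
        exact TensorProduct.ext' fun x y => by simp }
  have hf2 : ∀ a x y, wedgeForm (f2 a) x y = (2 : K)⁻¹ * (T a 1 x y - T a 1 y x) := by
    intro a x y
    rw [wedgeForm_apply]
    simp only [f2, LinearMap.coe_mk, AddHom.coe_mk, LinearMap.comp_apply, Submodule.subtype_apply,
      wedge, map_smul, map_sub, TensorProduct.lift.tmul, smul_eq_mul]
  have hf2lie : ∀ (a : A) (x y z : k), wedgeForm (f2 a) ⁅x, y⁆ z = T a 1 ⁅x, y⁆ z := by
    intro a x y z
    have h := antisymPart_eq_add hs a 1 ⁅x, y⁆ z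
    rw [hS] at h
    rw [hf2]
    field_simp
    linear_combination h
  let ft2 : A →ₗ[K] ↥(Zc2 K k) := f2.codRestrict (Zc2 K k) fun a => by
    rw [mem_Zc2_iff]
    intro x y z
    rw [hf2lie, hf2lie, hf2lie]
    exact (hF.move_of_antisymPart_eq_zero hS a 1 x y z).2
  set e := wedgeForm (F - PhiCocycle K A k P 0 ft2)
  have he_swap : ∀ u v, e u v = -e v u := wedgeForm_swap _
  have he_pure : ∀ a b x y, e (a ⊗ₜ x) (b ⊗ₜ y) = T a b x y - wedgeForm (f2 (a * b)) x y := by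
    intro a b x y
    change pureForm F a b x y - pureForm (PhiCocycle K A k P 0 ft2) a b x y = _
    rw [pureForm_PhiCocycle_zero hP]
    rfl
  have he_left : ∀ a x v, kAbMap K k x = 0 → e (a ⊗ₜ x) v = 0 := by
    intro a x v hx
    refine eq_zero_of_kAbMap_eq_zero (e.flip v ∘ₗ TensorProduct.mk K A k a) (fun y z => ?_) x hx
    change e (a ⊗ₜ ⁅y, z⁆) v = 0
    induction v using TensorProduct.induction_on with
    | zero => simp
    | add v v' hv hv' => rw [map_add, hv, hv', add_zero]
    | tmul b w =>
      rw [he_pure, hf2lie, (hF.move_of_antisymPart_eq_zero hS a b y z w).1, sub_self]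
  obtain ⟨s, hsec⟩ := (kAbMap K k).exists_rightInverse_of_surjective
    (LinearMap.range_eq_top.mpr kAbMap_surjective)
  have hsec' : ∀ x, kAbMap K k (s (kAbMap K k x) - x) = 0 := by
    intro x
    rw [map_sub, ← LinearMap.comp_apply, hsec, LinearMap.id_apply, sub_self]
  let σ : A ⊗[K] kAb K k →ₗ[K] A ⊗[K] k := TensorProduct.map LinearMap.id s
  have hσ : ∀ u v, e (σ (gAbMap K A k u)) v = e u v := by
    intro u v
    induction u using TensorProduct.induction_on with
    | zero => simp
    | add u u' hu hu' => simp only [map_add, LinearMap.add_apply, hu, hu']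
    | tmul a x =>
      have h := he_left a _ v (hsec' x)
      rw [TensorProduct.tmul_sub, map_sub, LinearMap.sub_apply, sub_eq_zero] at h
      exact h
  have hh : ∀ u v, e.compl₁₂ σ σ (gAbMap K A k u) (gAbMap K A k v) = e u v := by
    intro u v
    rw [LinearMap.compl₁₂_apply, hσ, he_swap, hσ, ← he_swap]
  have halt : ∀ u, e.compl₁₂ σ σ u u = 0 := by
    intro u
    have h := he_swap (σ u) (σ u)
    rw [LinearMap.compl₁₂_apply]
    refine mul_left_cancel₀ (two_ne_zero (α := K)) ?_
    linear_combination h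
  refine ⟨e.compl₁₂ σ σ, halt, fun a x y => ?_, ft2, fun u v => ?_⟩
  · simp only [← gAbMap_tmul, hh, he_pure, hf2, mul_one]
    field_simp
    ring
  · rw [wedgeForm_PhiCocycle halt, hh]
    simp [e, wedgeForm_apply]

end Phi

section Surjectivity

lemma exists_pureForm_eq (T : A →ₗ[K] A →ₗ[K] k →ₗ[K] k →ₗ[K] K)
    (hs : ∀ a b x y, T a b x y = -T b a y x) :
    ∃ F : ↥(lambda2 K (A ⊗[K] k)) →ₗ[K] K, pureForm F = T := by
  let G : (A ⊗[K] k) ⊗[K] (A ⊗[K] k) →ₗ[K] K :=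
    TensorProduct.lift (TensorProduct.lift
        (T.compr₂ (TensorProduct.uncurry (RingHom.id K) k k K : _ →ₗ[K] k ⊗[K] k →ₗ[K] K))) ∘ₗ
      (TensorProduct.tensorTensorTensorComm K A k A k).toLinearMap
  have hG : ∀ a b x y, G ((a ⊗ₜ x) ⊗ₜ (b ⊗ₜ y)) = T a b x y := fun _ _ _ _ => rfl
  refine ⟨G.comp (lambda2 K (A ⊗[K] k)).subtype, ?_⟩
  ext a b x y
  rw [pureForm_apply, wedgeForm_apply, restrict_wedge, hG]
  intro u v
  induction u using TensorProduct.induction_on with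
  | zero => simp
  | add u u' hu hu' =>
    rw [TensorProduct.add_tmul, TensorProduct.tmul_add, map_add, map_add, hu, hu', neg_add]
  | tmul a x =>
    induction v using TensorProduct.induction_on with
    | zero => simp
    | add u u' hu hu' =>
      rw [TensorProduct.add_tmul, TensorProduct.tmul_add, map_add, map_add, hu, hu', neg_add]
    | tmul b y => rw [hG, hG, hs]

lemma exists_linear_lift {U V W : Type*} [AddCommGroup U] [Module K U] [AddCommGroup V]
    [Module K V] [AddCommGroup W] [Module K W] (f : V →ₗ[K] W) (b : U →ₗ[K] W)
    (h : ∀ u, ∃ v, f v = b u) : ∃ c : U →ₗ[K] V, ∀ u, f (c u) = b u := by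
  obtain ⟨c, hc⟩ := Module.projective_lifting_property f.rangeRestrict
    (b.codRestrict (LinearMap.range f) h) f.surjective_rangeRestrict
  exact ⟨c, fun u => congrArg Subtype.val (LinearMap.congr_fun hc u)⟩

/-- The invariant symmetric bilinear forms on `k`. -/
def invariantForms (K k : Type*) [Field K] [CharZero K] [LieRing k] [LieAlgebra K k] :
    Submodule K (k →ₗ[K] k →ₗ[K] K) where
  carrier := {κ | (∀ x y : k, κ x y = κ y x) ∧ ∀ x y w : k, κ ⁅x, y⁆ w = κ x ⁅y, w⁆}
  add_mem' := by
    rintro κ κ' ⟨h1, h2⟩ ⟨h1', h2'⟩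
    exact ⟨fun x y => by simp [h1 x y, h1' x y], fun x y w => by simp [h2, h2']⟩
  zero_mem' := by simp
  smul_mem' := by
    rintro c κ ⟨h1, h2⟩
    exact ⟨fun x y => by simp [h1 x y], fun x y w => by simp [h2]⟩

/-- The alternating bilinear forms on `k`. -/
def alternatingForms (K k : Type*) [Field K] [CharZero K] [LieRing k] [LieAlgebra K k] :
    Submodule K (k →ₗ[K] k →ₗ[K] K) where
  carrier := {η | ∀ x : k, η x x = 0}
  add_mem' := fun h h' x => by simp [h x, h' x]
  zero_mem' := by simp
  smul_mem' := fun c η h x => by simp [h x]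

/-- Evaluation of a trilinear form, as a linear map into functions. -/
def trilinearEval (K k : Type*) [Field K] [CharZero K] [LieRing k] [LieAlgebra K k] :
    (k →ₗ[K] k →ₗ[K] k →ₗ[K] K) →ₗ[K] (k → k → k → K) where
  toFun τ x y w := τ x y w
  map_add' _ _ := rfl
  map_smul' _ _ := rfl

/-- The coboundary of bilinear forms, as a linear map into functions. -/
def coboundaryEval (K k : Type*) [Field K] [CharZero K] [LieRing k] [LieAlgebra K k] :
    (k →ₗ[K] k →ₗ[K] K) →ₗ[K] (k → k → k → K) where
  toFun η x y w := -(η ⁅x, y⁆ w) - η ⁅y, w⁆ x - η ⁅w, x⁆ y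
  map_add' η η' := by
    ext x y w
    simp only [LinearMap.add_apply, Pi.add_apply]
    ring
  map_smul' c η := by
    ext x y w
    simp only [LinearMap.smul_apply, Pi.smul_apply, smul_eq_mul, RingHom.id_apply]
    ring

lemma exists_cocycle_of_kaehler {P : ↥(lambda2 K (A ⊗[K] k)) ≃ₗ[K] Wspace K A k}
    (hP : IsDecomposition K P) (β : Ω[A⁄K] →ₗ[K] (k →ₗ[K] k →ₗ[K] k →ₗ[K] K))
    (hβ : ∀ ω : Ω[A⁄K], InImGamma K k (β ω))
    (hβD : ∀ a : A, InB3Gamma K k (β (KaehlerDifferential.D K A a))) :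
    ∃ F : ↥(lambda2 K (A ⊗[K] k)) →ₗ[K] K, F ∈ Zc2 K (A ⊗[K] k) ∧
      ∀ (a b : A) (x y w : k),
        β (a • KaehlerDifferential.D K A b - b • KaehlerDifferential.D K A a) x y w =
          gammaF K A k P F a b x y w := by
  obtain ⟨c₁, hc₁⟩ := exists_linear_lift
    ((trilinearEval K k ∘ₗ koszul K k) ∘ₗ (invariantForms K k).subtype) (trilinearEval K k ∘ₗ β)
    (fun ω => by
      obtain ⟨κ, h1, h2, h3⟩ := hβ ω
      exact ⟨⟨κ, h1, h2⟩, by ext x y w; exact (h3 x y w).symm⟩)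
  obtain ⟨c₂, hc₂⟩ := exists_linear_lift
    (coboundaryEval K k ∘ₗ (alternatingForms K k).subtype)
    (trilinearEval K k ∘ₗ β ∘ₗ (KaehlerDifferential.D K A : A →ₗ[K] Ω[A⁄K]))
    (fun a => by
      obtain ⟨-, η, h1, h2⟩ := hβD a
      exact ⟨⟨η, h1⟩, by ext x y w; exact (h2 x y w).symm⟩)
  have h₁ : ∀ ω x y w, (c₁ ω : k →ₗ[K] k →ₗ[K] K) ⁅x, y⁆ w = β ω x y w := fun ω x y w =>
    congrFun (congrFun (congrFun (hc₁ ω) x) y) w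
  have h₂ : ∀ a x y w, -((c₂ a : k →ₗ[K] k →ₗ[K] K) ⁅x, y⁆ w) - (c₂ a).1 ⁅y, w⁆ x
      - (c₂ a).1 ⁅w, x⁆ y = β (KaehlerDifferential.D K A a) x y w := fun a x y w =>
    congrFun (congrFun (congrFun (hc₂ a) x) y) w
  have hsymm : ∀ ω x y, (c₁ ω).1 x y = (c₁ ω).1 y x := fun ω => (c₁ ω).2.1
  have hcyc : ∀ ω x y z, (c₁ ω).1 ⁅x, y⁆ z = (c₁ ω).1 ⁅y, z⁆ x := fun ω x y z => by
    rw [(c₁ ω).2.2, hsymm]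
  have halt : ∀ a x y, (c₂ a).1 x y = -(c₂ a).1 y x := fun a => form_swap (c₂ a).2
  let ω : A →ₗ[K] A →ₗ[K] Ω[A⁄K] :=
    LinearMap.mk₂ K
      (fun a b => a • KaehlerDifferential.D K A b - b • KaehlerDifferential.D K A a)
      (fun a b c => by simp only [map_add, add_smul, smul_add]; abel)
      (fun c a b => by
        rw [Derivation.map_smul, smul_assoc, smul_comm b c, smul_sub])
      (fun a b c => by simp only [map_add, add_smul, smul_add]; abel)
      (fun c a b => by
        rw [Derivation.map_smul, smul_assoc, smul_comm a c, smul_sub])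
  have hω : ∀ a b, ω a b
      = a • KaehlerDifferential.D K A b - b • KaehlerDifferential.D K A a := fun _ _ => rfl
  let T₁ : A →ₗ[K] A →ₗ[K] k →ₗ[K] k →ₗ[K] K := ω.compr₂ ((invariantForms K k).subtype ∘ₗ c₁)
  let T₂ : A →ₗ[K] A →ₗ[K] k →ₗ[K] k →ₗ[K] K :=
    (LinearMap.mul K A).compr₂ ((alternatingForms K k).subtype ∘ₗ c₂)
  have hT : ∀ a b x y, (T₁ - T₂) a b x y = (c₁ (ω a b)).1 x y - (c₂ (a * b)).1 x y :=
    fun _ _ _ _ => rfl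
  obtain ⟨F, hF⟩ := exists_pureForm_eq (T₁ - T₂) (fun a b x y => by
    have e : ω b a = -ω a b := by rw [hω, hω, neg_sub]
    rw [hT, hT, e, map_neg, mul_comm b a, halt, hsymm]
    simp only [NegMemClass.coe_neg, LinearMap.neg_apply]
    ring)
  refine ⟨F, ?_, fun a b x y w => ?_⟩
  · rw [mem_Zc2_iff_pure, hF]
    intro a b c x y z
    have e : ω (a * b) c + ω (b * c) a + ω (c * a) b
        = -KaehlerDifferential.D K A (a * b * c) := by
      simp only [hω, Derivation.leibniz, smul_add, smul_smul]
      module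
    have e' := congrArg (fun w => β w x y z) e
    simp only [map_add, map_neg, LinearMap.add_apply, LinearMap.neg_apply, ← h₂] at e'
    simp only [← h₁] at e'
    rw [hT, hT, hT, hcyc _ z x y, ← hcyc _ x y z, show b * c * a = a * b * c by ring,
      show c * a * b = a * b * c by ring]
    linear_combination e'
  · rw [gammaF_eq hP, hF, hT, hT, ← hω, halt _ w, hsymm _ w, ← h₁]
    field_simp
    ring

end Surjectivity

end Helpers

/-- The sequence
`0 → H²(g/g')_{1,3} ⊕ Lin(A, H²(k)) →Φ H²(g) →Ψ Lin((Ω¹(A), d_A(A)), (Z³(k)_Γ, B³(k)_Γ)) → 0`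
is exact: `Φ` is injective (and well defined), `ker Ψ = im Φ`, and `Ψ` is surjective
(and well defined). -/
theorem statement17
    (P : ↥(lambda2 K (A ⊗[K] k)) ≃ₗ[K] Wspace K A k) (hP : IsDecomposition K P) :
    -- Φ takes values in 2-cocycles on g
    (∀ (h : (A ⊗[K] kAb K k) →ₗ[K] (A ⊗[K] kAb K k) →ₗ[K] K),
      (∀ u, h u u = 0) →
      (∀ (a : A) (x y : k),
        h (a ⊗ₜ[K] kAbMap K k x) ((1 : A) ⊗ₜ[K] kAbMap K k y) =
          h (a ⊗ₜ[K] kAbMap K k y) ((1 : A) ⊗ₜ[K] kAbMap K k x)) →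
      ∀ ft2 : A →ₗ[K] ↥(Zc2 K k),
        ∀ t : ↥(lambda2 K (A ⊗[K] k)),
          (t : (A ⊗[K] k) ⊗[K] (A ⊗[K] k)) ∈ B2 K (A ⊗[K] k) →
          PhiCocycle K A k P h ft2 t = 0) ∧
    -- Φ is injective
    (∀ (h : (A ⊗[K] kAb K k) →ₗ[K] (A ⊗[K] kAb K k) →ₗ[K] K),
      (∀ u, h u u = 0) →
      (∀ (a : A) (x y : k),
        h (a ⊗ₜ[K] kAbMap K k x) ((1 : A) ⊗ₜ[K] kAbMap K k y) =
          h (a ⊗ₜ[K] kAbMap K k y) ((1 : A) ⊗ₜ[K] kAbMap K k x)) →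
      ∀ ft2 : A →ₗ[K] ↥(Zc2 K k),
        (∃ ℓ : (A ⊗[K] k) →ₗ[K] K, ∀ u v : A ⊗[K] k,
          PhiCocycle K A k P h ft2 ⟨wedge K (A ⊗[K] k) u v, wedge_mem K u v⟩ =
            -ℓ ⁅u, v⁆) →
        h = 0 ∧ ∀ a : A, (Bc2 K k).mkQ ↑(ft2 a) = 0) ∧
    -- Ψ is well defined: each cocycle F induces a linear map
    -- Ω¹(A) → Z³(k)_Γ mapping d_A(A) into B³(k)_Γ
    (∀ F : ↥(lambda2 K (A ⊗[K] k)) →ₗ[K] K,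
      (∀ t : ↥(lambda2 K (A ⊗[K] k)),
        (t : (A ⊗[K] k) ⊗[K] (A ⊗[K] k)) ∈ B2 K (A ⊗[K] k) → F t = 0) →
      ∃ β : Ω[A⁄K] →ₗ[K] (k →ₗ[K] k →ₗ[K] k →ₗ[K] K),
        (∀ (a b : A) (x y w : k),
          β (a • KaehlerDifferential.D K A b - b • KaehlerDifferential.D K A a) x y w =
            gammaF K A k P F a b x y w) ∧
        (∀ ω : Ω[A⁄K], InImGamma K k (β ω)) ∧
        (∀ a : A, InB3Gamma K k (β (KaehlerDifferential.D K A a)))) ∧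
    -- Ψ is well defined on cohomology classes: it kills coboundaries
    (∀ F : ↥(lambda2 K (A ⊗[K] k)) →ₗ[K] K,
      (∃ ℓ : (A ⊗[K] k) →ₗ[K] K, ∀ u v : A ⊗[K] k,
        F ⟨wedge K (A ⊗[K] k) u v, wedge_mem K u v⟩ = -ℓ ⁅u, v⁆) →
      ∀ (a b : A) (x y w : k), gammaF K A k P F a b x y w = 0) ∧
    -- exactness in the middle: ker Ψ = im Φ
    (∀ F : ↥(lambda2 K (A ⊗[K] k)) →ₗ[K] K,
      (∀ t : ↥(lambda2 K (A ⊗[K] k)),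
        (t : (A ⊗[K] k) ⊗[K] (A ⊗[K] k)) ∈ B2 K (A ⊗[K] k) → F t = 0) →
      ((∀ (a b : A) (x y w : k), gammaF K A k P F a b x y w = 0) ↔
        ∃ h : (A ⊗[K] kAb K k) →ₗ[K] (A ⊗[K] kAb K k) →ₗ[K] K,
          (∀ u, h u u = 0) ∧
          (∀ (a : A) (x y : k),
            h (a ⊗ₜ[K] kAbMap K k x) ((1 : A) ⊗ₜ[K] kAbMap K k y) =
              h (a ⊗ₜ[K] kAbMap K k y) ((1 : A) ⊗ₜ[K] kAbMap K k x)) ∧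
          ∃ (ft2 : A →ₗ[K] ↥(Zc2 K k)) (ℓ : (A ⊗[K] k) →ₗ[K] K),
            ∀ u v : A ⊗[K] k,
              F ⟨wedge K (A ⊗[K] k) u v, wedge_mem K u v⟩ -
                PhiCocycle K A k P h ft2 ⟨wedge K (A ⊗[K] k) u v, wedge_mem K u v⟩ =
                  -ℓ ⁅u, v⁆)) ∧
    -- Ψ is surjective
    (∀ β : Ω[A⁄K] →ₗ[K] (k →ₗ[K] k →ₗ[K] k →ₗ[K] K),
      (∀ ω : Ω[A⁄K], InImGamma K k (β ω)) →
      (∀ a : A, InB3Gamma K k (β (KaehlerDifferential.D K A a))) →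
      ∃ F : ↥(lambda2 K (A ⊗[K] k)) →ₗ[K] K,
        (∀ t : ↥(lambda2 K (A ⊗[K] k)),
          (t : (A ⊗[K] k) ⊗[K] (A ⊗[K] k)) ∈ B2 K (A ⊗[K] k) → F t = 0) ∧
        ∀ (a b : A) (x y w : k),
          β (a • KaehlerDifferential.D K A b - b • KaehlerDifferential.D K A a) x y w =
            gammaF K A k P F a b x y w) := by
  refine ⟨fun h hh _ ft2 => PhiCocycle_mem hP hh ft2,
    fun h hh hsymm ft2 ⟨ℓ, hℓ⟩ => PhiCocycle_injective hP hh hsymm ft2 ℓ hℓ,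
    exists_kaehler_of_cocycle hP, fun F ⟨ℓ, hℓ⟩ => ?_, fun F hF => ⟨fun h0 => ?_, ?_⟩,
    exists_cocycle_of_kaehler hP⟩
  · refine gammaF_eq_zero_of_sub hP F (h := 0) (fun _ => rfl) 0 ℓ fun u v => ?_
    have e : wedgeForm (PhiCocycle K A k P 0 0) u v = 0 := by
      rw [wedgeForm_apply, PhiCocycle, lift_zero_form, LinearMap.comp_zero, lift_zero_form,
        LinearMap.zero_comp, LinearMap.zero_comp, add_zero, LinearMap.zero_apply]
    rw [e, sub_zero]
    exact hℓ u v
  · obtain ⟨h, hh, hsymm, ft2, heq⟩ := exists_PhiCocycle_eq hP F hF h0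
    refine ⟨h, hh, hsymm, ft2, 0, fun u v => ?_⟩
    rw [LinearMap.zero_apply, neg_zero, sub_eq_zero]
    exact heq u v
  · rintro ⟨h, hh, -, ft2, ℓ, hℓ⟩
    exact gammaF_eq_zero_of_sub hP F hh ft2 ℓ hℓ

end CurrentPaper
end
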